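/- arXiv:math/0608491 — 2 statements merged into one kernel-verified Lean document; each statement's English description precedes it below -/
import Mathlib

section
/- For every field k and every integer n ≥ 11, the Krull dimension of R_n(k) is strictly greater than n^2. -/
open MvPolynomial in
/-- The defining relations of the moduli space of based rank-`n` algebras:
commutativity `c_{ijl} - c_{jil}`, associativity
`Σ_m c_{ijm} c_{mkl} - Σ_m c_{jkm} c_{iml}`, and the unit relations
`Σ_i d_i c_{ijl} - δ_{jl}`.  The variable `Sum.inl (i,j,l)` is `c_{ijl}` and
`Sum.inr i` is `d_i`. -/
def structRels (k : Type) [CommRing k] (n : ℕ) :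
    Set (MvPolynomial ((Fin n × Fin n × Fin n) ⊕ Fin n) k) :=
  (Set.range fun t : Fin n × Fin n × Fin n =>
      (X (Sum.inl (t.1, t.2.1, t.2.2)) : MvPolynomial ((Fin n × Fin n × Fin n) ⊕ Fin n) k)
        - X (Sum.inl (t.2.1, t.1, t.2.2)))
  ∪ (Set.range fun t : Fin n × Fin n × Fin n × Fin n =>
      (∑ m : Fin n, X (Sum.inl (t.1, t.2.1, m)) * X (Sum.inl (m, t.2.2.1, t.2.2.2)))
        - ∑ m : Fin n, X (Sum.inl (t.2.1, t.2.2.1, m)) * X (Sum.inl (t.1, m, t.2.2.2)))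
  ∪ (Set.range fun t : Fin n × Fin n =>
      (∑ i : Fin n, X (Sum.inr i) * X (Sum.inl (i, t.1, t.2)))
        - if t.1 = t.2 then 1 else 0)

/-- `Rring k n` is the coordinate ring of the moduli space `B_{n,k}` of based
rank-`n` algebras: the polynomial ring in the `n^3 + n` variables `c_{ijl}`, `d_i`
modulo the commutativity, associativity and unit relations. -/
abbrev Rring (k : Type) [CommRing k] (n : ℕ) : Type :=
  MvPolynomial ((Fin n × Fin n × Fin n) ⊕ Fin n) k ⧸ Ideal.span (structRels k n)

open MvPolynomial in
/-- Set the variables in `s` to zero. -/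
noncomputable def evz {σ : Type} (k : Type) [Field k] (s : Set σ) :
    MvPolynomial σ k →ₐ[k] MvPolynomial σ k :=
  open Classical in aeval (fun y => if y ∈ s then 0 else X y)

open MvPolynomial in
lemma evz_X_mem {σ k : Type} [Field k] (s : Set σ) (y : σ) (h : y ∈ s) :
    evz k s (X y) = 0 := by simp [evz, h]

open MvPolynomial in
lemma evz_X_notMem {σ k : Type} [Field k] (s : Set σ) (y : σ) (h : y ∉ s) :
    evz k s (X y) = X y := by simp [evz, h]

open MvPolynomial in
lemma evz_evz {σ k : Type} [Field k] (s t : Set σ) (h : s ⊆ t) (p : MvPolynomial σ k) :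
    evz k t (evz k s p) = evz k t p := by
  have : (evz k t).comp (evz k s) = evz k t := by
    apply MvPolynomial.algHom_ext
    intro i
    by_cases hi : i ∈ s
    · simp [evz_X_mem s i hi, evz_X_mem t i (h hi)]
    · simp [evz_X_notMem s i hi]
  exact DFunLike.congr_fun this p

open MvPolynomial in
lemma card_le_dim {R σ k : Type} [CommRing R] [Field k] [Fintype σ]
    (φ : R →+* MvPolynomial σ k) (rank : σ → ℕ)
    (H : ∀ x, ∃ r h, evz k {y | rank y < rank x} (φ r) = h * X x ∧
      evz k {y | rank y ≤ rank x} h ≠ 0) :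
    ((Fintype.card σ : ℕ) : WithBot (WithTop ℕ)) ≤ ringKrullDim R := by
  set d := Fintype.card σ with hd
  let e0 : σ ≃ Fin d := Fintype.equivFin σ
  let e : Fin d ≃ σ := (Tuple.sort (rank ∘ e0.symm)).trans e0.symm
  have hmono : Monotone (rank ∘ e) := Tuple.monotone_sort (rank ∘ e0.symm)
  let s : Fin (d + 1) → Set σ := fun i => {y | (e.symm y).castSucc < i}
  let q : Fin (d + 1) → PrimeSpectrum R := fun i =>
    ⟨RingHom.ker ((evz k (s i)).toRingHom.comp φ), RingHom.ker_isPrime _⟩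
  have hq : StrictMono q := by
    rw [Fin.strictMono_iff_lt_succ]
    intro i
    have hsub : s i.castSucc ⊆ s i.succ := fun y hy =>
      lt_trans hy (Fin.castSucc_lt_succ)
    have h1 : {y | rank y < rank (e i)} ⊆ s i.castSucc := by
      intro y hy
      simp only [s, Set.mem_ofPred_eq, Fin.castSucc_lt_castSucc_iff] at hy ⊢
      by_contra hc
      have := hmono (not_lt.mp hc)
      simp at this
      omega
    have h2 : s i.castSucc ⊆ {y | rank y ≤ rank (e i)} := by
      intro y hy
      simp only [s, Set.mem_ofPred_eq, Fin.castSucc_lt_castSucc_iff] at hy ⊢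
      have := hmono hy.le
      simpa using this
    obtain ⟨r, h, hr, hh⟩ := H (e i)
    have hr' : ∀ t, {y | rank y < rank (e i)} ⊆ t →
        evz k t (φ r) = evz k t h * evz k t (X (e i)) := by
      intro t ht
      rw [← evz_evz _ t ht (φ r), hr, map_mul]
    refine lt_of_le_of_ne ?_ ?_
    · intro x hx
      have hx' : evz k (s i.castSucc) (φ x) = 0 := hx
      change evz k (s i.succ) (φ x) = 0
      rw [← evz_evz _ _ hsub, hx', map_zero]
    · intro heq
      have hm : r ∈ (q i.succ).asIdeal := by
        change evz k (s i.succ) (φ r) = 0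
        rw [hr' _ (h1.trans hsub), evz_X_mem _ (e i), mul_zero]
        simp [s]
      rw [← heq] at hm
      have hm' : evz k (s i.castSucc) (φ r) = 0 := hm
      rw [hr' _ h1, evz_X_notMem _ (e i) (by simp [s])] at hm'
      rcases mul_eq_zero.mp hm' with h0 | h0
      · apply hh
        rw [← evz_evz _ _ h2, h0, map_zero]
      · exact X_ne_zero _ h0
  exact Order.LTSeries.length_le_krullDim (LTSeries.mk d q hq)

open MvPolynomial in
/-- A based algebra gives a point of `B_n`. -/
lemma exists_hom {k P N : Type} [Field k] [CommRing P] [Algebra k P] [AddCommGroup N] [Module P N]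
    (n : ℕ) (b : Module.Basis (Fin n) P N) (μ : N → N → N) (one : N)
    (hadd : ∀ x y z, μ (x + y) z = μ x z + μ y z)
    (hsmul : ∀ (p : P) x z, μ (p • x) z = p • μ x z)
    (hcomm : ∀ x y, μ x y = μ y x)
    (hassoc : ∀ x y z, μ (μ x y) z = μ x (μ y z))
    (hone : ∀ x, μ one x = x) :
    ∃ φ : Rring k n →+* P, (∀ i j l, b.repr (μ (b i) (b j)) l ∈ φ.range) ∧
      (∀ i, b.repr one i ∈ φ.range) ∧ (∀ c : k, algebraMap k P c ∈ φ.range) := by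
  let μl : N → N →ₗ[P] N := fun z =>
    { toFun := fun x => μ x z, map_add' := fun x y => hadd x y z, map_smul' := fun p x => hsmul p x z }
  have key : ∀ (x z : N) (l : Fin n),
      ∑ m, b.repr x m * b.repr (μ (b m) z) l = b.repr (μ x z) l := by
    intro x z l
    have : μ x z = ∑ m, b.repr x m • μ (b m) z := by
      change μl z x = ∑ m, b.repr x m • μl z (b m)
      conv_lhs => rw [← b.sum_repr x]
      simp only [map_sum, map_smul]
    rw [this]
    simp [Finsupp.finsetSum_apply]
  let f : MvPolynomial ((Fin n × Fin n × Fin n) ⊕ Fin n) k →ₐ[k] P :=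
    aeval (Sum.elim (fun t => b.repr (μ (b t.1) (b t.2.1)) t.2.2) (fun i => b.repr one i))
  have hf : ∀ a ∈ Ideal.span (structRels k n), f.toRingHom a = 0 := by
    intro a ha
    have hle : Ideal.span (structRels k n) ≤ RingHom.ker f.toRingHom := by
      rw [Ideal.span_le]
      rintro _ ((⟨⟨i, j, l⟩, rfl⟩ | ⟨⟨i, j, m, l⟩, rfl⟩) | ⟨⟨j, l⟩, rfl⟩)
      · change f _ = 0
        simp [f, hcomm (b i) (b j)]
      · change f _ = 0
        simp only [f, map_sub, map_sum, map_mul, aeval_X, Sum.elim_inl]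
        rw [key, sub_eq_zero, hassoc, hcomm (b i), ← key]
        simp only [hcomm (b i)]
      · change f _ = 0
        simp only [f, map_sub, map_sum, map_mul, aeval_X, Sum.elim_inl, Sum.elim_inr]
        rw [key, hone]
        by_cases h : j = l
        · simp [h]
        · simp [h]
    exact hle ha
  refine ⟨Ideal.Quotient.lift _ f.toRingHom hf, ?_, ?_, ?_⟩
  · intro i j l
    refine ⟨Ideal.Quotient.mk _ (X (Sum.inl (i, j, l))), ?_⟩
    simp [f]
  · intro i
    refine ⟨Ideal.Quotient.mk _ (X (Sum.inr i)), ?_⟩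
    simp [f]
  · intro c
    refine ⟨Ideal.Quotient.mk _ (C c), ?_⟩
    simp [f]

section family
variable {P : Type} [CommRing P] {a : ℕ}

/-- The underlying module of the family. -/
abbrev NN (P : Type) (a : ℕ) : Type := P × (Fin a → P) × (Fin 4 → P)

/-- The symmetric bilinear map. -/
def bet (c : Sym2 (Fin a) → Fin 4 → P) (v w : Fin a → P) : Fin 4 → P :=
  fun l => ∑ i, ∑ j, c s(i, j) l * v i * w j

lemma bet_comm (c : Sym2 (Fin a) → Fin 4 → P) (v w : Fin a → P) : bet c v w = bet c w v := by
  funext l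
  unfold bet
  rw [Finset.sum_comm]
  refine Finset.sum_congr rfl fun i _ => Finset.sum_congr rfl fun j _ => ?_
  rw [Sym2.eq_swap]; ring

lemma bet_add (c : Sym2 (Fin a) → Fin 4 → P) (u v w : Fin a → P) :
    bet c (u + v) w = bet c u w + bet c v w := by
  funext l
  simp only [bet, Pi.add_apply, ← Finset.sum_add_distrib]
  refine Finset.sum_congr rfl fun i _ => Finset.sum_congr rfl fun j _ => ?_
  ring

lemma bet_smul (c : Sym2 (Fin a) → Fin 4 → P) (p : P) (v w : Fin a → P) :
    bet c (p • v) w = p • bet c v w := by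
  funext l
  simp only [bet, Pi.smul_apply, smul_eq_mul, Finset.mul_sum]
  refine Finset.sum_congr rfl fun i _ => Finset.sum_congr rfl fun j _ => ?_
  ring

lemma bet_add' (c : Sym2 (Fin a) → Fin 4 → P) (u v w : Fin a → P) :
    bet c w (u + v) = bet c w u + bet c w v := by
  rw [bet_comm, bet_add, bet_comm c u, bet_comm c v]

lemma bet_smul' (c : Sym2 (Fin a) → Fin 4 → P) (p : P) (v w : Fin a → P) :
    bet c w (p • v) = p • bet c w v := by
  rw [bet_comm, bet_smul, bet_comm c v]

lemma bet_single (c : Sym2 (Fin a) → Fin 4 → P) (i j : Fin a) :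
    bet c (Pi.single i 1) (Pi.single j 1) = c s(i, j) := by
  funext l
  simp [bet, Pi.single_apply]

/-- The multiplication. -/
def mulN (c : Sym2 (Fin a) → Fin 4 → P) (x y : NN P a) : NN P a :=
  (x.1 * y.1, x.1 • y.2.1 + y.1 • x.2.1, x.1 • y.2.2 + y.1 • x.2.2 + bet c x.2.1 y.2.1)

lemma mulN_comm (c : Sym2 (Fin a) → Fin 4 → P) (x y : NN P a) : mulN c x y = mulN c y x := by
  unfold mulN
  rw [bet_comm, mul_comm, add_comm (x.1 • y.2.1), add_comm (x.1 • y.2.2)]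

lemma mulN_add (c : Sym2 (Fin a) → Fin 4 → P) (x y z : NN P a) :
    mulN c (x + y) z = mulN c x z + mulN c y z := by
  simp only [mulN, Prod.fst_add, Prod.snd_add, bet_add, Prod.mk_add_mk]
  refine Prod.ext (by ring) (Prod.ext ?_ ?_) <;> dsimp only <;> module

lemma mulN_smul (c : Sym2 (Fin a) → Fin 4 → P) (p : P) (x z : NN P a) :
    mulN c (p • x) z = p • mulN c x z := by
  simp only [mulN, Prod.smul_fst, Prod.smul_snd, bet_smul, Prod.smul_mk, smul_eq_mul]
  refine Prod.ext (by dsimp only; ring) (Prod.ext ?_ ?_) <;> dsimp only <;> module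

lemma mulN_assoc (c : Sym2 (Fin a) → Fin 4 → P) (x y z : NN P a) :
    mulN c (mulN c x y) z = mulN c x (mulN c y z) := by
  simp only [mulN, bet_add, bet_add', bet_smul, bet_smul']
  refine Prod.ext (by dsimp only; ring) (Prod.ext ?_ ?_) <;> dsimp only <;> module

lemma mulN_one (c : Sym2 (Fin a) → Fin 4 → P) (x : NN P a) :
    mulN c (1, 0, 0) x = x := by
  have : bet c 0 x.2.1 = 0 := by funext l; simp [bet]
  simp [mulN, this]

/-- Coordinates. -/
def LL (d : Fin a ⊕ Fin 4 → P) (s : Fin a → Fin 4 → P) (t : Fin a → P) :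
    NN P a ≃ₗ[P] (Option (Fin a ⊕ Fin 4) → P) where
  toFun x := fun o =>
    let u : Fin a → P := fun m => x.2.1 m + ∑ l, s m l * x.2.2 l
    let y : P := x.1 - ∑ m, t m * u m
    match o with
    | none => y
    | some (Sum.inl m) => u m + y * d (Sum.inl m)
    | some (Sum.inr l) => x.2.2 l + y * d (Sum.inr l)
  invFun α :=
    let w : Fin 4 → P := fun l => α (some (Sum.inr l)) - α none * d (Sum.inr l)
    let u : Fin a → P := fun m => α (some (Sum.inl m)) - α none * d (Sum.inl m)
    (α none + ∑ m, t m * u m, fun m => u m - ∑ l, s m l * w l, w)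
  map_add' x y := by
    funext o
    rcases o with _ | m | l <;>
      simp only [Prod.fst_add, Prod.snd_add, Pi.add_apply, mul_add, Finset.sum_add_distrib] <;> ring
  map_smul' p x := by
    funext o
    have h1 : ∀ m, ∑ l, s m l * (p * x.2.2 l) = p * ∑ l, s m l * x.2.2 l := by
      intro m; rw [Finset.mul_sum]; exact Finset.sum_congr rfl fun _ _ => by ring
    have h2 : ∑ m, t m * (p * (x.2.1 m + ∑ l, s m l * x.2.2 l))
        = p * ∑ m, t m * (x.2.1 m + ∑ l, s m l * x.2.2 l) := by
      rw [Finset.mul_sum]; exact Finset.sum_congr rfl fun _ _ => by ring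
    rcases o with _ | m | l <;>
      simp only [Prod.smul_fst, Prod.smul_snd, Pi.smul_apply, smul_eq_mul, h1, ← mul_add, h2,
        RingHom.id_apply] <;> ring
  left_inv x := by
    refine Prod.ext ?_ (Prod.ext ?_ ?_)
    · simp
    · funext m; simp
    · funext l; simp
  right_inv α := by
    funext o
    rcases o with _ | m | l <;> simp

end family

lemma exists_family {k P : Type} [Field k] [CommRing P] [Algebra k P] (a n : ℕ) (hn : n = a + 5)
    (d : Fin a ⊕ Fin 4 → P) (s : Fin a → Fin 4 → P) (t : Fin a → P)
    (c : Sym2 (Fin a) → Fin 4 → P) :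
    ∃ φ : Rring k n →+* P, (∀ o, d o ∈ φ.range) ∧ (∀ p l, c p l ∈ φ.range) ∧
      ∀ i j m : Fin a, (t i * (if m = j then 1 else 0) + t j * (if m = i then 1 else 0)
        + ∑ l, s m l * c s(i, j) l) ∈ φ.range := by
  let e : Option (Fin a ⊕ Fin 4) ≃ Fin n := Fintype.equivFinOfCardEq (by simp [hn])
  let b0 : Module.Basis (Option (Fin a ⊕ Fin 4)) P (NN P a) := Module.Basis.ofEquivFun (LL d s t)
  let b := b0.reindex e
  obtain ⟨φ, h1, h2, -⟩ := exists_hom (k := k) n b (mulN c) (1, 0, 0) (mulN_add c) (mulN_smul c)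
    (mulN_comm c) (mulN_assoc c) (mulN_one c)
  have hb : ∀ i : Fin a, b (e (some (Sum.inl i))) = (t i, Pi.single i 1, 0) := by
    intro i
    simp only [b, b0, Module.Basis.reindex_apply, Equiv.symm_apply_apply,
      Module.Basis.coe_ofEquivFun]
    rw [LinearEquiv.symm_apply_eq]
    funext o
    rcases o with _ | m | l <;> simp [LL, Pi.single_apply, Function.update_apply]
  have hr : ∀ x o, b.repr x (e o) = LL d s t x o := by
    intro x o
    simp [b, b0, Module.Basis.repr_reindex]
  have hd : ∀ o, d o ∈ φ.range := by
    intro o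
    have := h2 (e (some o))
    rw [hr] at this
    rcases o with m | l <;> simpa [LL] using this
  have hm : ∀ (i j : Fin a) o, LL d s t (mulN c (t i, Pi.single i 1, 0) (t j, Pi.single j 1, 0)) o
      ∈ φ.range := by
    intro i j o
    have := h1 (e (some (Sum.inl i))) (e (some (Sum.inl j))) (e o)
    rwa [hr, hb, hb] at this
  refine ⟨φ, hd, ?_, ?_⟩
  · intro p l
    induction p using Sym2.ind with
    | _ i j =>
      have h := sub_mem (hm i j (some (Sum.inr l))) (mul_mem (hm i j none) (hd (Sum.inr l)))
      convert h using 1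
      simp [LL, mulN, bet_single]
  · intro i j m
    have h := sub_mem (hm i j (some (Sum.inl m))) (mul_mem (hm i j none) (hd (Sum.inl m)))
    convert h using 1
    simp [LL, mulN, bet_single, Pi.single_apply]

/-- The parameters of the family. -/
abbrev Par (a : ℕ) : Type :=
  (Fin a ⊕ Fin 4) ⊕ (Fin a × Fin 4) ⊕ Fin a ⊕ (Sym2 (Fin a) × Fin 4)

/-- Colour of a pair. -/
def col {a : ℕ} (p : Sym2 (Fin a)) : ℕ :=
  Sym2.lift ⟨fun i j => (i.val + j.val) % 4, fun i j => by dsimp only; rw [add_comm]⟩ p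

/-- Rank of a parameter. -/
def rk {a : ℕ} : Par a → ℕ
  | Sum.inl _ => 0
  | Sum.inr (Sum.inl _) => 1
  | Sum.inr (Sum.inr (Sum.inl _)) => 2
  | Sum.inr (Sum.inr (Sum.inr (p, l))) => if col p = l.val then 3 else 0

lemma exists_pair (a : ℕ) (ha : 6 ≤ a) (m : Fin a) (l : Fin 4) :
    ∃ i j : Fin a, m ≠ i ∧ m ≠ j ∧ col s(i, j) = l.val := by
  have H : ∀ x y : ℕ, x < 4 → y < 4 → m.val ≠ x → m.val ≠ y → (x + y) % 4 = l.val →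
      ∃ i j : Fin a, m ≠ i ∧ m ≠ j ∧ col s(i, j) = l.val := by
    intro x y hx hy h1 h2 h3
    refine ⟨⟨x, by omega⟩, ⟨y, by omega⟩, ?_, ?_, h3⟩
    · intro h; exact h1 (congrArg Fin.val h)
    · intro h; exact h2 (congrArg Fin.val h)
  have hl := l.isLt
  rcases (by omega : l.val = 0 ∨ l.val = 1 ∨ l.val = 2 ∨ l.val = 3) with h | h | h | h
  · by_cases h0 : m.val = 0
    · exact H 2 2 (by omega) (by omega) (by omega) (by omega) (by omega)
    · exact H 0 0 (by omega) (by omega) (by omega) (by omega) (by omega)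
  · by_cases h0 : m.val = 0 ∨ m.val = 1
    · exact H 2 3 (by omega) (by omega) (by omega) (by omega) (by omega)
    · exact H 0 1 (by omega) (by omega) (by omega) (by omega) (by omega)
  · by_cases h0 : m.val = 1
    · exact H 0 2 (by omega) (by omega) (by omega) (by omega) (by omega)
    · exact H 1 1 (by omega) (by omega) (by omega) (by omega) (by omega)
  · by_cases h0 : m.val = 0 ∨ m.val = 3
    · exact H 1 2 (by omega) (by omega) (by omega) (by omega) (by omega)
    · exact H 0 3 (by omega) (by omega) (by omega) (by omega) (by omega)

lemma card_Par (a : ℕ) : Fintype.card (Par a) = 2 * a ^ 2 + 8 * a + 4 := by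
  have h : (a + 1).choose 2 * 2 = (a + 1) * a := by
    rw [Nat.choose_two_right]
    exact Nat.div_mul_cancel (Nat.even_mul_pred_self (a + 1)).two_dvd
  simp only [Fintype.card_sum, Fintype.card_prod, Sym2.card, Fintype.card_fin]
  nlinarith

open MvPolynomial in
lemma dim_ge (k : Type) [Field k] (a n : ℕ) (ha : 6 ≤ a) (hn : n = a + 5) :
    ((Fintype.card (Par a) : ℕ) : WithBot (WithTop ℕ)) ≤ ringKrullDim (Rring k n) := by
  obtain ⟨φ, hd, hc, hs⟩ := exists_family (k := k) (P := MvPolynomial (Par a) k) a n hn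
    (fun o => X (Sum.inl o)) (fun m l => X (Sum.inr (Sum.inl (m, l))))
    (fun i => X (Sum.inr (Sum.inr (Sum.inl i))))
    (fun p l => X (Sum.inr (Sum.inr (Sum.inr (p, l)))))
  refine card_le_dim φ rk ?_
  have direct : ∀ x : Par a, X x ∈ φ.range →
      ∃ r h, evz k {y | rk y < rk x} (φ r) = h * X x ∧ evz k {y | rk y ≤ rk x} h ≠ 0 := by
    rintro x ⟨r, hr⟩
    refine ⟨r, 1, ?_, by simp⟩
    rw [hr, evz_X_notMem _ _ (by simp), one_mul]
  rintro (o | ⟨m, l⟩ | i | ⟨p, l⟩)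
  · exact direct _ (hd o)
  · obtain ⟨i, j, hi, hj, hcol⟩ := exists_pair a ha m l
    obtain ⟨r, hr⟩ := hs i j m
    refine ⟨r, X (Sum.inr (Sum.inr (Sum.inr (s(i, j), l)))), ?_, ?_⟩
    · rw [hr]
      simp only [if_neg hi, if_neg hj, mul_zero, add_zero, zero_add, map_sum, map_mul]
      rw [Finset.sum_eq_single l]
      · rw [evz_X_notMem _ _ (by simp), evz_X_notMem _ _ (by simp [rk, hcol]), mul_comm]
      · intro l' _ hl'
        have : col s(i, j) ≠ l'.val := by
          rw [hcol]; intro h; exact hl' (Fin.ext h.symm)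
        rw [evz_X_mem _ (Sum.inr (Sum.inr (Sum.inr (s(i, j), l')))) (by simp [rk, this]), mul_zero]
      · simp
    · rw [evz_X_notMem _ _ (by simp [rk, hcol])]
      exact X_ne_zero _
  · obtain ⟨j, hj⟩ : ∃ j : Fin a, j ≠ i :=
      haveI : Nontrivial (Fin a) := Fin.nontrivial_iff_two_le.mpr (by omega)
      exists_ne i
    obtain ⟨r, hr⟩ := hs i j j
    refine ⟨r, 1, ?_, by simp⟩
    rw [hr]
    simp only [if_neg hj, if_true, mul_one, mul_zero, add_zero, map_add, map_sum, map_mul]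
    rw [Finset.sum_eq_zero, evz_X_notMem _ _ (by simp), one_mul, add_zero]
    intro l _
    rw [evz_X_mem _ (Sum.inr (Sum.inl (j, l))) (by simp [rk]), zero_mul]
  · exact direct _ (hc p l)

/-- For every field `k` and every `n ≥ 11`, the Krull dimension of `R_n(k)` is
strictly greater than `n²`. -/
theorem stmt6 (k : Type) [Field k] (n : ℕ) (hn : 11 ≤ n) :
    ((n ^ 2 : ℕ) : WithBot (WithTop ℕ)) < ringKrullDim (Rring k n) := by
  obtain ⟨a, rfl⟩ : ∃ a, n = a + 5 := ⟨n - 5, by omega⟩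
  refine lt_of_lt_of_le ?_ (dim_ge k a (a + 5) (by omega) rfl)
  rw [card_Par]
  have h : (a + 5) ^ 2 < 2 * a ^ 2 + 8 * a + 4 := by nlinarith
  exact_mod_cast h
end

section
/- For every field k and every integer n ≥ 1, the k-algebra R_n(k) is smooth over k if and only if n ≤ 3. -/
structure Valid {B : Type} [CommRing B] (n : ℕ) (c : Fin n → Fin n → Fin n → B)
    (d : Fin n → B) : Prop where
  comm : ∀ i j l, c i j l = c j i l
  assoc : ∀ i j k l, ∑ m, c i j m * c m k l = ∑ m, c j k m * c i m l
  unit : ∀ j l, ∑ i, d i * c i j l = if j = l then 1 else 0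

theorem sum_unit_aux {B : Type} [CommRing B] {n : ℕ} (d A : Fin n → B) (i0 : Fin n)
    (hu : IsUnit (d i0)) (h : ∑ i, d i * A i = 0) (h0 : ∀ i, i ≠ i0 → A i = 0) (i : Fin n) :
    A i = 0 := by
  by_cases hi : i = i0
  · subst hi
    rw [Finset.sum_eq_single i (fun b _ hb => by rw [h0 b hb, mul_zero]) (by simp)] at h
    exact (hu.mul_right_eq_zero).1 h
  · exact h0 i hi

theorem valid_of {B : Type} [CommRing B] {n : ℕ} (c : Fin n → Fin n → Fin n → B)
    (d : Fin n → B) (i0 : Fin n) (hu : IsUnit (d i0))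
    (comm : ∀ i j l, c i j l = c j i l)
    (unit : ∀ j l, ∑ i, d i * c i j l = if j = l then 1 else 0)
    (assoc : ∀ i j k l, i ≠ i0 → j ≠ i0 → k ≠ i0 →
      ∑ m, c i j m * c m k l = ∑ m, c j k m * c i m l) : Valid n c d := by
  let A : Fin n → Fin n → Fin n → Fin n → B := fun i j k l =>
    ∑ m, c i j m * c m k l - ∑ m, c j k m * c i m l
  have hA1 : ∀ j k l, ∑ i, d i * A i j k l = 0 := by
    intro j k l
    have e1 : ∑ i, d i * ∑ m, c i j m * c m k l = c j k l := by
      simp_rw [Finset.mul_sum]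
      rw [Finset.sum_comm]
      simp_rw [← mul_assoc, ← Finset.sum_mul, unit]
      simp
    have e2 : ∑ i, d i * ∑ m, c j k m * c i m l = c j k l := by
      simp_rw [Finset.mul_sum]
      rw [Finset.sum_comm]
      simp_rw [mul_left_comm, ← Finset.mul_sum, unit]
      simp
    simp only [A, mul_sub, Finset.sum_sub_distrib, e1, e2, sub_self]
  have hA2 : ∀ i k l, ∑ j, d j * A i j k l = 0 := by
    intro i k l
    have e1 : ∑ j, d j * ∑ m, c i j m * c m k l = c i k l := by
      simp_rw [Finset.mul_sum]
      rw [Finset.sum_comm]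
      simp_rw [comm i, ← mul_assoc, ← Finset.sum_mul, unit]
      simp [comm i k]
    have e2 : ∑ j, d j * ∑ m, c j k m * c i m l = c i k l := by
      simp_rw [Finset.mul_sum]
      rw [Finset.sum_comm]
      simp_rw [← mul_assoc, ← Finset.sum_mul, unit]
      simp
    simp only [A, mul_sub, Finset.sum_sub_distrib, e1, e2, sub_self]
  have hsymm : ∀ i j k l, A i j k l = - A k j i l := by
    intro i j k l
    have e1 : ∑ m, c i j m * c m k l = ∑ m, c j i m * c k m l :=
      Finset.sum_congr rfl fun m _ => by rw [comm i j, comm m k]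
    have e2 : ∑ m, c j k m * c i m l = ∑ m, c k j m * c m i l :=
      Finset.sum_congr rfl fun m _ => by rw [comm k j, comm m i]
    simp only [A, e1, e2]; ring
  have z0 : ∀ i j k l, i ≠ i0 → j ≠ i0 → k ≠ i0 → A i j k l = 0 := fun i j k l h1 h2 h3 =>
    sub_eq_zero.2 (assoc i j k l h1 h2 h3)
  have z1 : ∀ i j k l, j ≠ i0 → k ≠ i0 → A i j k l = 0 := fun i j k l h2 h3 =>
    sum_unit_aux d (fun i => A i j k l) i0 hu (hA1 j k l) (fun i h1 => z0 i j k l h1 h2 h3) i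
  have z2 : ∀ i j k l, k ≠ i0 → A i j k l = 0 := fun i j k l h3 =>
    sum_unit_aux d (fun j => A i j k l) i0 hu (hA2 i k l) (fun j h1 => z1 i j k l h1 h3) j
  have z2' : ∀ i j k l, i ≠ i0 → A i j k l = 0 := fun i j k l h3 => by
    rw [hsymm, z2 _ _ _ _ h3, neg_zero]
  have z3 : ∀ i j k l, A i j k l = 0 := fun i j k l =>
    sum_unit_aux d (fun i => A i j k l) i0 hu (hA1 j k l) (fun i h1 => z2' i j k l h1) i
  exact ⟨comm, fun i j k l => sub_eq_zero.1 (z3 i j k l), unit⟩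

theorem Valid.perm {B : Type} [CommRing B] {n : ℕ} {c : Fin n → Fin n → Fin n → B}
    {d : Fin n → B} (h : Valid n c d) (σ : Equiv.Perm (Fin n)) :
    Valid n (fun i j l => c (σ i) (σ j) (σ l)) (fun i => d (σ i)) where
  comm i j l := h.comm _ _ _
  assoc i j k l := by
    rw [Equiv.sum_comp σ (fun m => c (σ i) (σ j) m * c m (σ k) (σ l)),
      Equiv.sum_comp σ (fun m => c (σ j) (σ k) m * c (σ i) m (σ l))]
    exact h.assoc _ _ _ _
  unit j l := by
    rw [Equiv.sum_comp σ (fun i => d i * c i (σ j) (σ l)), h.unit]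
    simp

/-! ### Homomorphisms out of `Rring` -/

section hom
variable {k : Type} [Field k] {n : ℕ} {B : Type} [CommRing B] [Algebra k B]

noncomputable def cc (k : Type) [Field k] (n : ℕ) (i j l : Fin n) : Rring k n :=
  Ideal.Quotient.mk _ (MvPolynomial.X (Sum.inl (i, j, l)))

noncomputable def dd (k : Type) [Field k] (n : ℕ) (i : Fin n) : Rring k n :=
  Ideal.Quotient.mk _ (MvPolynomial.X (Sum.inr i))

theorem valid_univ (k : Type) [Field k] (n : ℕ) : Valid n (cc k n) (dd k n) where
  comm i j l := by
    refine Ideal.Quotient.eq.2 (Ideal.subset_span ?_)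
    exact Or.inl (Or.inl ⟨(i, j, l), rfl⟩)
  assoc i j p l := by
    simp only [cc, ← map_mul, ← map_sum]
    refine Ideal.Quotient.eq.2 (Ideal.subset_span ?_)
    exact Or.inl (Or.inr ⟨(i, j, p, l), rfl⟩)
  unit j l := by
    have : (if j = l then (1 : Rring k n) else 0) =
        Ideal.Quotient.mk _ (if j = l then 1 else 0) := by split_ifs <;> simp
    rw [this]
    simp only [cc, dd, ← map_mul, ← map_sum]
    refine Ideal.Quotient.eq.2 (Ideal.subset_span ?_)
    exact Or.inr ⟨(j, l), rfl⟩

theorem Valid.map {A C : Type} [CommRing A] [CommRing C] (f : A →+* C)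
    {c : Fin n → Fin n → Fin n → A} {d : Fin n → A} (h : Valid n c d) :
    Valid n (fun i j l => f (c i j l)) (fun i => f (d i)) where
  comm i j l := by rw [h.comm]
  assoc i j p l := by
    simp only [← map_mul, ← map_sum, h.assoc]
  unit j l := by
    simp only [← map_mul, ← map_sum, h.unit]
    split_ifs <;> simp

theorem exists_hom_s8 (k : Type) [Field k] {n : ℕ} {B : Type} [CommRing B] [Algebra k B]
    {c : Fin n → Fin n → Fin n → B} {d : Fin n → B} (h : Valid n c d) :
    ∃ f : Rring k n →ₐ[k] B, (∀ i j l, f (cc k n i j l) = c i j l) ∧ ∀ i, f (dd k n i) = d i := by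
  let g : MvPolynomial ((Fin n × Fin n × Fin n) ⊕ Fin n) k →ₐ[k] B :=
    MvPolynomial.aeval (Sum.elim (fun t => c t.1 t.2.1 t.2.2) d)
  have hg : ∀ a ∈ Ideal.span (structRels k n), g a = 0 := by
    intro a ha
    have : Ideal.span (structRels k n) ≤ RingHom.ker g := by
      rw [Ideal.span_le]
      rintro _ ((⟨⟨i, j, l⟩, rfl⟩ | ⟨⟨i, j, p, l⟩, rfl⟩) | ⟨⟨j, l⟩, rfl⟩)
      · simp [g, h.comm i j l]
      · simp [g, h.assoc i j p l]
      · have := h.unit j l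
        simp only [SetLike.mem_coe, RingHom.mem_ker, map_sub, map_sum, map_mul, g,
          MvPolynomial.aeval_X, Sum.elim_inl, Sum.elim_inr, this]
        split_ifs <;> simp
    exact this ha
  refine ⟨Ideal.Quotient.liftₐ _ g hg, ?_, ?_⟩
  · intro i j l
    exact (MvPolynomial.aeval_X _ _)
  · intro i
    exact (MvPolynomial.aeval_X _ _)

theorem hom_ext' {f g : Rring k n →ₐ[k] B} (h1 : ∀ i j l, f (cc k n i j l) = g (cc k n i j l))
    (h2 : ∀ i, f (dd k n i) = g (dd k n i)) : f = g := by
  apply Ideal.Quotient.algHom_ext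
  apply MvPolynomial.algHom_ext
  rintro (⟨i, j, l⟩ | i)
  · exact h1 i j l
  · exact h2 i

end hom

/-! ### Non-smoothness for `n ≥ 4` -/

theorem fin_dist (m : ℕ) : (1 : Fin (m + 4)) ≠ 2 ∧ (1 : Fin (m + 4)) ≠ 3 ∧
    (2 : Fin (m + 4)) ≠ 3 ∧ (0 : Fin (m + 4)) ≠ 1 ∧ (0 : Fin (m + 4)) ≠ 2 ∧
    (0 : Fin (m + 4)) ≠ 3 := by
  have h2 : 2 % (m + 4) = 2 := Nat.mod_eq_of_lt (by omega)
  have h3 : 3 % (m + 4) = 3 := Nat.mod_eq_of_lt (by omega)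
  simp [Fin.ext_iff, h2, h3]

theorem exists_test_ring (k : Type) [Field k] : ∃ (B : Type) (_ : CommRing B) (_ : Algebra k B)
    (s t : B), s * s = 0 ∧ t * t = 0 ∧ s * t ≠ 0 := by
  refine ⟨DualNumber (DualNumber k), inferInstance, inferInstance,
    TrivSqZeroExt.inl DualNumber.eps, DualNumber.eps, ?_, DualNumber.eps_mul_eps, ?_⟩
  · rw [← TrivSqZeroExt.inl_mul, DualNumber.eps_mul_eps, TrivSqZeroExt.inl_zero]
  · intro h
    have := congrArg (fun x => (TrivSqZeroExt.snd (TrivSqZeroExt.snd x))) h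
    simp at this

theorem valid_bad {C : Type} [CommRing C] (m : ℕ) (s t : C) (hst : s * t = 0) :
    Valid (m + 4) (fun i j l => if i = 0 then (if j = l then 1 else 0) else
      if j = 0 then (if i = l then 1 else 0) else
      if i = 1 ∧ j = 1 ∧ l = 2 then s else if i = 2 ∧ j = 2 ∧ l = 3 then t else 0)
      (fun i => if i = 0 then (1 : C) else 0) := by
  obtain ⟨h12, h13, h23, h01, h02, h03⟩ := fin_dist m
  refine valid_of _ _ 0 (by simp) ?_ ?_ ?_
  · intro i j l
    grind
  · intro j l
    rw [Finset.sum_eq_single 0]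
    · simp
    · intro x _ hx
      simp [hx]
    · simp
  · intro i j p l hi hj hp
    rw [Finset.sum_eq_zero, Finset.sum_eq_zero]
    · intro x _
      grind
    · intro x _
      grind

theorem not_smooth (k : Type) [Field k] (m : ℕ) : ¬ Algebra.Smooth k (Rring k (m + 4)) := by
  intro hS
  have hF : Algebra.FormallySmooth k (Rring k (m + 4)) := hS.formallySmooth
  obtain ⟨B, _, _, s, t, hs, ht, hst⟩ := exists_test_ring k
  let I : Ideal B := Ideal.span {s * t}
  have hI : I ^ 2 = ⊥ := by
    rw [Ideal.span_singleton_pow, Ideal.span_singleton_eq_bot]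
    linear_combination t ^ 2 * hs
  have hmem : ∀ x y : B, Ideal.Quotient.mk I x = Ideal.Quotient.mk I y →
      ∃ a, x = y + a * (s * t) := by
    intro x y h
    obtain ⟨a, ha⟩ := Ideal.mem_span_singleton'.1 (Ideal.Quotient.eq.1 h)
    exact ⟨a, by rw [ha]; ring⟩
  obtain ⟨f, hf1, hf2⟩ := exists_hom_s8 k (valid_bad m (Ideal.Quotient.mk I s)
    (Ideal.Quotient.mk I t) (by
      rw [← map_mul]
      exact Ideal.Quotient.eq_zero_iff_mem.2 (Ideal.subset_span rfl)))
  obtain ⟨g, hg⟩ := Algebra.FormallySmooth.comp_surjective k _ I hI f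
  have hv := (valid_univ k (m + 4)).map (g : Rring k (m + 4) →+* B)
  set c : Fin (m + 4) → Fin (m + 4) → Fin (m + 4) → B := fun i j l => g (cc k _ i j l) with hc
  have hcm : ∀ i j l, Ideal.Quotient.mk I (c i j l) = f (cc k _ i j l) := by
    intro i j l
    rw [← hg]; rfl
  obtain ⟨h12, h13, h23, h01, h02, h03⟩ := fin_dist m
  have ha : ∑ x, c 1 1 x * c x 2 3 = ∑ x, c 1 2 x * c 1 x 3 := hv.assoc 1 1 2 3
  have e1 : ∀ x, ∃ a, c 1 1 x = (if x = 2 then s else 0) + a * (s * t) := by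
    intro x
    apply hmem
    rw [hcm, hf1]
    grind
  have e2 : ∀ x, ∃ a, c x 2 3 = (if x = 2 then t else 0) + a * (s * t) := by
    intro x
    apply hmem
    rw [hcm, hf1]
    grind
  have e3 : ∀ x, ∃ a, c 1 2 x = 0 + a * (s * t) := by
    intro x
    apply hmem
    rw [hcm, hf1]
    grind
  have e4 : ∀ x, ∃ a, c 1 x 3 = 0 + a * (s * t) := by
    intro x
    apply hmem
    rw [hcm, hf1]
    grind
  have f1 : ∑ x, c 1 1 x * c x 2 3 = s * t := by
    rw [Finset.sum_eq_single 2]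
    · obtain ⟨a, ha⟩ := e1 2
      obtain ⟨b, hb⟩ := e2 2
      rw [ha, hb, if_pos rfl, if_pos rfl]
      linear_combination (b * t + a * b * t ^ 2) * hs + a * s * ht
    · intro x _ hx
      obtain ⟨a, ha⟩ := e1 x
      obtain ⟨b, hb⟩ := e2 x
      rw [ha, hb, if_neg hx, if_neg hx]
      linear_combination (a * b * t ^ 2) * hs
    · simp
  have f2 : ∑ x, c 1 2 x * c 1 x 3 = 0 := by
    apply Finset.sum_eq_zero
    intro x _
    obtain ⟨a, ha⟩ := e3 x
    obtain ⟨b, hb⟩ := e4 x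
    rw [ha, hb]
    linear_combination (a * b * t ^ 2) * hs
  exact hst (by rw [← f1, ha, f2])

/-! ### Lifting for `n ≤ 3` -/

def LiftOK (n : ℕ) (i0 : Fin n) : Prop :=
  ∀ (B : Type) [CommRing B] (I : Ideal B) (_ : I ^ 2 = ⊥)
    (c : Fin n → Fin n → Fin n → B ⧸ I) (d : Fin n → B ⧸ I), Valid n c d → IsUnit (d i0) →
    ∃ (c' : Fin n → Fin n → Fin n → B) (d' : Fin n → B), Valid n c' d' ∧
      (∀ i j l, Ideal.Quotient.mk I (c' i j l) = c i j l) ∧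
      ∀ i, Ideal.Quotient.mk I (d' i) = d i

theorem LiftOK.perm {n : ℕ} {i0 : Fin n} (h : LiftOK n i0) (i : Fin n) : LiftOK n i := by
  intro B _ I hI c d hv hu
  let σ := Equiv.swap i0 i
  obtain ⟨c', d', hv', h1, h2⟩ := h B I hI _ _ (hv.perm σ) (by simpa [σ] using hu)
  refine ⟨_, _, hv'.perm σ, ?_, ?_⟩
  · intro i j l
    simp [h1, σ]
  · intro i
    simp [h2, σ]

theorem exists_inv {B : Type} [CommRing B] (I : Ideal B) (hI : I ^ 2 = ⊥) (x : B)
    (hx : IsUnit (Ideal.Quotient.mk I x)) : ∃ u, x * u = 1 := by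
  have := (IsNilpotent.isUnit_quotient_mk_iff ⟨2, hI⟩).1 hx
  exact this.exists_right_inv

theorem lift1 : LiftOK 1 0 := by
  intro B _ I hI c d hv hu
  obtain ⟨d0, hd0⟩ := Ideal.Quotient.mk_surjective (d 0)
  obtain ⟨u, hu'⟩ := exists_inv I hI d0 (by rwa [hd0])
  have h := hv.unit 0 0
  simp at h
  refine ⟨fun _ _ _ => u, fun _ => d0, ⟨by simp, by simp, ?_⟩, ?_, ?_⟩
  · intro j l
    simp [Subsingleton.elim j l, hu']
  · intro i j l
    have e : c i j l = c 0 0 0 := by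
      rw [Subsingleton.elim i 0, Subsingleton.elim j 0, Subsingleton.elim l 0]
    rw [e]
    have h2 := congrArg (Ideal.Quotient.mk I) hu'
    rw [map_mul, map_one, hd0] at h2
    linear_combination (c 0 0 0) * h2 - (Ideal.Quotient.mk I u) * h
  · intro i
    rw [Subsingleton.elim i 0, hd0]

def M2 {B : Type} [CommRing B] (d0 d1 u p q : B) : Fin 2 → Fin 2 → Fin 2 → B :=
  let c11 : Fin 2 → B := ![p * d0, p * d1 + q]
  let c01 : Fin 2 → B := ![u * (0 - d1 * c11 0), u * (1 - d1 * c11 1)]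
  let c00 : Fin 2 → B := ![u * (1 - d1 * c01 0), u * (0 - d1 * c01 1)]
  ![![c00, c01], ![c01, c11]]

theorem lift2 : LiftOK 2 0 := by
  intro B _ I hI c d hv hu
  obtain ⟨d0, hd0⟩ := Ideal.Quotient.mk_surjective (d 0)
  obtain ⟨d1, hd1⟩ := Ideal.Quotient.mk_surjective (d 1)
  obtain ⟨u, hu'⟩ := exists_inv I hI d0 (by rwa [hd0])
  obtain ⟨p, hp⟩ := Ideal.Quotient.mk_surjective (Ideal.Quotient.mk I u * c 1 1 0)
  obtain ⟨q, hq⟩ := Ideal.Quotient.mk_surjective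
    (c 1 1 1 - Ideal.Quotient.mk I u * c 1 1 0 * d 1)
  have hm := congrArg (Ideal.Quotient.mk I) hu'
  rw [map_mul, map_one, hd0] at hm
  refine ⟨M2 d0 d1 u p q, ![d0, d1], valid_of _ _ 0 (IsUnit.of_mul_eq_one u hu') ?_ ?_ ?_, ?_, ?_⟩
  · intro i j l
    fin_cases i <;> fin_cases j <;> rfl
  · intro j l
    fin_cases j <;> fin_cases l <;> simp [M2, Fin.sum_univ_two] <;> grind
  · intro i j p l hi hj hp
    have : i = 1 := by omega
    have : j = 1 := by omega
    have : p = 1 := by omega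
    subst i j p
    fin_cases l <;> simp [M2, Fin.sum_univ_two]
  · have h00 := hv.unit 0 0
    have h01 := hv.unit 0 1
    have h10 := hv.unit 1 0
    have h11 := hv.unit 1 1
    have hc := hv.comm 0 1
    simp [Fin.sum_univ_two] at h00 h01 h10 h11
    generalize hvu : Ideal.Quotient.mk I u = v at *
    have a0 : ∀ l, c 1 1 l = ![v * c 1 1 0 * d 0, v * c 1 1 0 * d 1 +
      (c 1 1 1 - v * c 1 1 0 * d 1)] l := by
      intro l
      fin_cases l <;> simp
      linear_combination (- c 1 1 0) * hm
    intro i j l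
    fin_cases i <;> fin_cases j <;> fin_cases l <;> simp [M2, hd0, hd1, hp, hq, hvu] <;> grind
  · intro i
    fin_cases i <;> simp [hd0, hd1]

def M3 {B : Type} [CommRing B] (d0 d1 d2 u q r b c v w : B) : Fin 3 → Fin 3 → Fin 3 → B :=
  let p := b * r + c ^ 2 - q * c - r * w
  let a := r * v - b * c
  let t := b ^ 2 + c * v - b * w - q * v
  let c11 : Fin 3 → B := ![p * d0, p * d1 + q, p * d2 + r]
  let c12 : Fin 3 → B := ![a * d0, a * d1 + b, a * d2 + c]
  let c22 : Fin 3 → B := ![t * d0, t * d1 + v, t * d2 + w]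
  let c01 : Fin 3 → B := ![u * (0 - d1 * c11 0 - d2 * c12 0), u * (1 - d1 * c11 1 - d2 * c12 1),
    u * (0 - d1 * c11 2 - d2 * c12 2)]
  let c02 : Fin 3 → B := ![u * (0 - d1 * c12 0 - d2 * c22 0), u * (0 - d1 * c12 1 - d2 * c22 1),
    u * (1 - d1 * c12 2 - d2 * c22 2)]
  let c00 : Fin 3 → B := ![u * (1 - d1 * c01 0 - d2 * c02 0), u * (0 - d1 * c01 1 - d2 * c02 1),
    u * (0 - d1 * c01 2 - d2 * c02 2)]
  ![![c00, c01, c02], ![c01, c11, c12], ![c02, c12, c22]]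

theorem M3_valid {B : Type} [CommRing B] (d0 d1 d2 u q r b c v w : B) (hu : d0 * u = 1) :
    Valid 3 (M3 d0 d1 d2 u q r b c v w) ![d0, d1, d2] := by
  have comm : ∀ i j l, M3 d0 d1 d2 u q r b c v w i j l = M3 d0 d1 d2 u q r b c v w j i l := by
    intro i j l
    fin_cases i <;> fin_cases j <;> rfl
  have A1 : ∀ l, ∑ m, M3 d0 d1 d2 u q r b c v w 1 1 m * M3 d0 d1 d2 u q r b c v w m 2 l =
      ∑ m, M3 d0 d1 d2 u q r b c v w 1 2 m * M3 d0 d1 d2 u q r b c v w 1 m l := by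
    intro l
    fin_cases l <;> simp [M3, Fin.sum_univ_three] <;> grind
  have A2 : ∀ l, ∑ m, M3 d0 d1 d2 u q r b c v w 2 2 m * M3 d0 d1 d2 u q r b c v w m 1 l =
      ∑ m, M3 d0 d1 d2 u q r b c v w 2 1 m * M3 d0 d1 d2 u q r b c v w 2 m l := by
    intro l
    fin_cases l <;> simp [M3, Fin.sum_univ_three] <;> grind
  refine valid_of _ _ 0 (IsUnit.of_mul_eq_one u hu) comm ?_ ?_
  · intro j l
    fin_cases j <;> fin_cases l <;> simp [M3, Fin.sum_univ_three] <;> grind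
  · have sw : ∀ i j k l, ∑ m, M3 d0 d1 d2 u q r b c v w i j m * M3 d0 d1 d2 u q r b c v w m k l =
      ∑ m, M3 d0 d1 d2 u q r b c v w j i m * M3 d0 d1 d2 u q r b c v w k m l := by
      intro i j k l
      exact Finset.sum_congr rfl fun m _ => by rw [comm i j, comm m k]
    intro i j k l hi hj hk
    have hi' : i = 1 ∨ i = 2 := by omega
    have hj' : j = 1 ∨ j = 2 := by omega
    have hk' : k = 1 ∨ k = 2 := by omega
    rcases hi' with rfl | rfl <;> rcases hj' with rfl | rfl <;> rcases hk' with rfl | rfl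
    · exact sw _ _ _ _
    · exact A1 l
    · exact sw _ _ _ _
    · rw [sw, ← A2 l]
      exact Finset.sum_congr rfl fun m _ => by rw [comm 1 m]
    · rw [sw, ← A1 l]
      exact Finset.sum_congr rfl fun m _ => by rw [comm 2 m]
    · exact sw _ _ _ _
    · exact A2 l
    · exact sw _ _ _ _

theorem M3_class {B : Type} [CommRing B] (cs : Fin 3 → Fin 3 → Fin 3 → B) (d : Fin 3 → B) (u : B)
    (hu : d 0 * u = 1) (hv : Valid 3 cs d) : ∃ q r b c v w,
    cs = M3 (d 0) (d 1) (d 2) u q r b c v w := by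
  obtain ⟨p, q, r, hp0, hp1, hp2⟩ : ∃ p q r, cs 1 1 0 = p * d 0 ∧ cs 1 1 1 = p * d 1 + q ∧
      cs 1 1 2 = p * d 2 + r :=
    ⟨u * cs 1 1 0, cs 1 1 1 - u * cs 1 1 0 * d 1, cs 1 1 2 - u * cs 1 1 0 * d 2,
      by linear_combination (- cs 1 1 0) * hu, by ring, by ring⟩
  obtain ⟨a, b, c, ha0, ha1, ha2⟩ : ∃ p q r, cs 1 2 0 = p * d 0 ∧ cs 1 2 1 = p * d 1 + q ∧
      cs 1 2 2 = p * d 2 + r :=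
    ⟨u * cs 1 2 0, cs 1 2 1 - u * cs 1 2 0 * d 1, cs 1 2 2 - u * cs 1 2 0 * d 2,
      by linear_combination (- cs 1 2 0) * hu, by ring, by ring⟩
  obtain ⟨t, v, w, ht0, ht1, ht2⟩ : ∃ p q r, cs 2 2 0 = p * d 0 ∧ cs 2 2 1 = p * d 1 + q ∧
      cs 2 2 2 = p * d 2 + r :=
    ⟨u * cs 2 2 0, cs 2 2 1 - u * cs 2 2 0 * d 1, cs 2 2 2 - u * cs 2 2 0 * d 2,
      by linear_combination (- cs 2 2 0) * hu, by ring, by ring⟩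
  have U : ∀ j l, d 0 * cs 0 j l + d 1 * cs 1 j l + d 2 * cs 2 j l = if j = l then 1 else 0 := by
    intro j l
    rw [← hv.unit j l, Fin.sum_univ_three]
  have c21 := hv.comm 2 1
  have c10 := hv.comm 1 0
  have c20 := hv.comm 2 0
  -- (e1 e1) e2 = e1 (e1 e2)
  have E1 : ∀ l, p * (if (2 : Fin 3) = l then 1 else 0) + q * cs 1 2 l + r * cs 2 2 l =
      a * (if (1 : Fin 3) = l then 1 else 0) + b * cs 1 1 l + c * cs 1 2 l := by
    intro l
    have h := hv.assoc 1 1 2 l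
    simp only [Fin.sum_univ_three, hp0, hp1, hp2, ha0, ha1, ha2, c10] at h
    have h1 := U 2 l
    have h2 := U 1 l
    rw [c21] at h2
    linear_combination h - p * h1 + a * h2
  have E2 : ∀ l, t * (if (1 : Fin 3) = l then 1 else 0) + v * cs 1 1 l + w * cs 1 2 l =
      a * (if (2 : Fin 3) = l then 1 else 0) + b * cs 1 2 l + c * cs 2 2 l := by
    intro l
    have h := hv.assoc 2 2 1 l
    simp only [Fin.sum_univ_three, ht0, ht1, ht2, c21, c20, ha0, ha1, ha2] at h
    have h1 := U 1 l
    rw [c21] at h1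
    have h2 := U 2 l
    linear_combination h - t * h1 + a * h2
  have E10 := E1 0
  have E11 := E1 1
  have E12 := E1 2
  have E20 := E2 0
  have E21 := E2 1
  have E22 := E2 2
  simp [hp0, hp1, hp2, ha0, ha1, ha2, ht0, ht1, ht2] at E10 E11 E12 E20 E21 E22
  have K1 : q * a + r * t - b * p - c * a = 0 := by
    linear_combination u * E10 - (q * a + r * t - b * p - c * a) * hu
  have K2 : v * p + w * a - b * a - c * t = 0 := by
    linear_combination u * E20 - (v * p + w * a - b * a - c * t) * hu
  have La : a = r * v - b * c := by linear_combination - E11 + d 1 * K1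
  have Lp : p = b * r + c ^ 2 - q * c - r * w := by linear_combination E12 - d 2 * K1
  have Lt : t = b ^ 2 + c * v - b * w - q * v := by linear_combination E21 - d 1 * K2
  have S : ∀ x y : B, d 0 * x = y → x = u * y := by
    intro x y h
    linear_combination u * h - x * hu
  have V1 : ∀ l, cs 0 1 l = u * ((if (1 : Fin 3) = l then 1 else 0) - d 1 * cs 1 1 l
      - d 2 * cs 1 2 l) := by
    intro l
    apply S
    rw [← U 1 l, c21]; ring
  have V2 : ∀ l, cs 0 2 l = u * ((if (2 : Fin 3) = l then 1 else 0) - d 1 * cs 1 2 l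
      - d 2 * cs 2 2 l) := by
    intro l
    apply S
    rw [← U 2 l]; ring
  have V0 : ∀ l, cs 0 0 l = u * ((if (0 : Fin 3) = l then 1 else 0) - d 1 * cs 0 1 l
      - d 2 * cs 0 2 l) := by
    intro l
    apply S
    rw [← U 0 l, c10, c20]; ring
  refine ⟨q, r, b, c, v, w, ?_⟩
  rw [La] at ha0 ha1 ha2
  rw [Lp] at hp0 hp1 hp2
  rw [Lt] at ht0 ht1 ht2
  funext i j l
  fin_cases i <;> fin_cases j <;> fin_cases l <;>
    simp [M3, V0, V1, V2, c10, c20, c21, hp0, hp1, hp2, ha0, ha1, ha2, ht0, ht1, ht2]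

theorem M3_map {B C : Type} [CommRing B] [CommRing C] (f : B →+* C)
    (d0 d1 d2 u q r b c v w : B) (i j l : Fin 3) :
    f (M3 d0 d1 d2 u q r b c v w i j l) =
      M3 (f d0) (f d1) (f d2) (f u) (f q) (f r) (f b) (f c) (f v) (f w) i j l := by
  fin_cases i <;> fin_cases j <;> fin_cases l <;> simp [M3]

theorem lift3 : LiftOK 3 0 := by
  intro B _ I hI c d hv hu
  obtain ⟨d0, hd0⟩ := Ideal.Quotient.mk_surjective (d 0)
  obtain ⟨d1, hd1⟩ := Ideal.Quotient.mk_surjective (d 1)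
  obtain ⟨d2, hd2⟩ := Ideal.Quotient.mk_surjective (d 2)
  obtain ⟨u, hu'⟩ := exists_inv I hI d0 (by rwa [hd0])
  have hm := congrArg (Ideal.Quotient.mk I) hu'
  rw [map_mul, map_one, hd0] at hm
  obtain ⟨q, r, b, x, v, w, hcs⟩ := M3_class c d _ hm hv
  obtain ⟨q, rfl⟩ := Ideal.Quotient.mk_surjective q
  obtain ⟨r, rfl⟩ := Ideal.Quotient.mk_surjective r
  obtain ⟨b, rfl⟩ := Ideal.Quotient.mk_surjective b
  obtain ⟨x, rfl⟩ := Ideal.Quotient.mk_surjective x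
  obtain ⟨v, rfl⟩ := Ideal.Quotient.mk_surjective v
  obtain ⟨w, rfl⟩ := Ideal.Quotient.mk_surjective w
  refine ⟨M3 d0 d1 d2 u q r b x v w, ![d0, d1, d2], M3_valid _ _ _ _ _ _ _ _ _ _ hu', ?_, ?_⟩
  · intro i j l
    rw [M3_map, hcs, hd0, hd1, hd2]
  · intro i
    fin_cases i <;> simp [hd0, hd1, hd2]

theorem formallySmooth_away (k : Type) [Field k] (n : ℕ) (i : Fin n) (h : LiftOK n i) :
    Algebra.FormallySmooth k (Localization.Away (dd k n i)) := by
  refine Algebra.FormallySmooth.of_comp_surjective ?_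
  intro B _ _ I hI f
  let ι : Rring k n →ₐ[k] Localization.Away (dd k n i) := IsScalarTower.toAlgHom _ _ _
  let f0 : Rring k n →ₐ[k] B ⧸ I := f.comp ι
  have hv := (valid_univ k n).map (f0 : Rring k n →+* B ⧸ I)
  have hunit : IsUnit (f0 (dd k n i)) := by
    have : IsUnit (ι (dd k n i)) := IsLocalization.Away.algebraMap_isUnit (dd k n i)
    exact this.map f
  obtain ⟨c', d', hv', h1, h2⟩ := h B I hI _ _ hv hunit
  obtain ⟨g, hg1, hg2⟩ := exists_hom_s8 k hv'
  have hgf : (Ideal.Quotient.mkₐ k I).comp g = f0 := by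
    apply hom_ext'
    · intro i j l
      exact (congrArg (Ideal.Quotient.mk I) (hg1 i j l)).trans (h1 i j l)
    · intro i
      exact (congrArg (Ideal.Quotient.mk I) (hg2 i)).trans (h2 i)
  have hgu : IsUnit (g (dd k n i)) := by
    apply (IsNilpotent.isUnit_quotient_mk_iff ⟨2, hI⟩).1
    have : Ideal.Quotient.mk I (g (dd k n i)) = f0 (dd k n i) := by rw [← hgf]; rfl
    rwa [this]
  have hgu' : ∀ y : Submonoid.powers (dd k n i), IsUnit (g y) := by
    rintro ⟨_, m, rfl⟩
    simpa using hgu.pow m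
  refine ⟨IsLocalization.liftAlgHom (M := Submonoid.powers (dd k n i)) (f := g) hgu', ?_⟩
  apply IsLocalization.algHom_ext (Submonoid.powers (dd k n i))
  apply AlgHom.ext
  intro x
  have e1 : IsLocalization.liftAlgHom (M := Submonoid.powers (dd k n i)) (f := g) hgu'
      (algebraMap (Rring k n) (Localization.Away (dd k n i)) x) = g x :=
    IsLocalization.lift_eq _ _
  have e2 : Ideal.Quotient.mk I (g x) = f0 x := by rw [← hgf]; rfl
  exact (congrArg (Ideal.Quotient.mk I) e1).trans e2

theorem smooth_of_lift (k : Type) [Field k] (n : ℕ) (i0 : Fin n) (h : LiftOK n i0) :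
    Algebra.Smooth k (Rring k n) := by
  have hfp : Algebra.FinitePresentation k (Rring k n) := by
    have : Algebra.FiniteType k (Rring k n) := inferInstance
    exact Algebra.FinitePresentation.of_finiteType.1 this
  refine ⟨?_, hfp⟩
  rw [← Algebra.smoothLocus_eq_univ_iff, Set.eq_univ_iff_forall]
  intro p
  have : ∃ i, dd k n i ∉ p.asIdeal := by
    by_contra! hcon
    apply p.isPrime.ne_top
    rw [Ideal.eq_top_iff_one]
    have := (valid_univ k n).unit i0 i0
    rw [if_pos rfl] at this
    rw [← this]
    exact Ideal.sum_mem _ fun i _ => Ideal.mul_mem_right _ _ (hcon i)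
  obtain ⟨i, hi⟩ := this
  have := formallySmooth_away k n i (h.perm i)
  exact Algebra.basicOpen_subset_smoothLocus_iff.2 this hi

/-- For every field `k` and every `n ≥ 1`, the `k`-algebra `R_n(k)` is smooth
(finitely presented and formally smooth) if and only if `n ≤ 3`. -/
theorem stmt8 (k : Type) [Field k] (n : ℕ) (hn : 1 ≤ n) :
    Algebra.Smooth k (Rring k n) ↔ n ≤ 3 := by
  constructor
  · intro h
    by_contra hn
    obtain ⟨m, rfl⟩ : ∃ m, n = m + 4 := ⟨n - 4, by omega⟩
    exact not_smooth k m h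
  · intro h
    have : n = 1 ∨ n = 2 ∨ n = 3 := by omega
    rcases this with rfl | rfl | rfl
    · exact smooth_of_lift k 1 0 lift1
    · exact smooth_of_lift k 2 0 lift2
    · exact smooth_of_lift k 3 0 lift3
end
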